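/- Let A be a commutative Noetherian ring and B = A[x₁,…,xₙ]/(f₁,…,fₙ) a finite flat A-algebra with quotient map π. Let (a_ij) be a matrix over A[x₁,…,xₙ]⊗_A A[x₁,…,xₙ] with f_j⊗1 − 1⊗f_j = Σ_i a_ij (x_i⊗1 − 1⊗x_i), and set Δ = (π⊗π)(det(a_ij)) ∈ B⊗_A B. Then the B-linear map χ(Δ): Hom_A(B,A) → B, given by φ ↦ φ(b)·c summed over a representation Δ = Σ b⊗c, is an isomorphism of B-modules; in particular Hom_A(B,A) is a free B-module of rank 1. -/

import Mathlib

open TensorProduct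

set_option synthInstance.maxHeartbeats 4000000
set_option maxHeartbeats 4000000

/-- The canonical `A`-linear map `χ : B ⊗_A B → Hom_A(Hom_A(B, A), B)`, sending `b ⊗ c` to the
homomorphism `φ ↦ φ(b)·c`. -/
noncomputable def chi (A B : Type*) [CommRing A] [CommRing B] [Algebra A B] :
    TensorProduct A B B →ₗ[A] (Module.Dual A B →ₗ[A] B) :=
  (dualTensorHom A (Module.Dual A B) B).comp
    (TensorProduct.map (Module.Dual.eval A B) LinearMap.id)

namespace MvPolynomial

theorem coeff_mul_X_pow_eq_zero {σ R : Type*} [CommSemiring R] {m : σ →₀ ℕ} {i : σ} {k : ℕ}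
    (h : m i < k) (p : MvPolynomial σ R) : coeff m (p * X i ^ k) = 0 := by
  rw [X_pow_eq_monomial, coeff_mul_monomial', if_neg]
  intro hle
  have := hle i
  simp at this
  omega

/-- The top coefficient of a determinant vanishes when one row is a syzygy of the variables. -/
theorem coeff_det_eq_zero {σ R : Type*} [Fintype σ] [DecidableEq σ] [CommRing R] {m : σ →₀ ℕ}
    (Q : Matrix σ σ (MvPolynomial σ R)) (j : σ) (hj : Q.mulVec X j = 0)
    (hQ : ∀ k, X k ^ (m k + 1) ∣ Q.mulVec X k) : coeff m Q.det = 0 := by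
  have key : Q.det * X j = ∑ k, Q.adjugate j k * Q.mulVec X k := by
    have h : (Q.adjugate.mulVec (Q.mulVec X)) j = (Q.det • X) j := by
      rw [Matrix.mulVec_mulVec, Matrix.adjugate_mul, Matrix.smul_mulVec, Matrix.one_mulVec]
    simpa [Matrix.mulVec, dotProduct] using h.symm
  rw [← coeff_mul_X m j, key, coeff_sum]
  refine Finset.sum_eq_zero fun k _ => ?_
  by_cases hk : k = j
  · rw [hk, hj, mul_zero, coeff_zero]
  · obtain ⟨u, hu⟩ := hQ k
    rw [hu, mul_comm (X k ^ _), ← mul_assoc]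
    exact coeff_mul_X_pow_eq_zero (by simp [Ne.symm hk]) _

theorem coeff_det_congr {σ R : Type*} [Fintype σ] [DecidableEq σ] [CommRing R] {m : σ →₀ ℕ}
    (M D : Matrix σ σ (MvPolynomial σ R)) (h : M.mulVec X = D.mulVec X)
    (hD : ∀ k, X k ^ (m k + 1) ∣ D.mulVec X k) : coeff m M.det = coeff m D.det := by
  suffices H : ∀ s : Finset σ,
      coeff m (Matrix.of fun j => if j ∈ s then D j else M j).det = coeff m M.det by
    rw [← H Finset.univ]; simp; rfl
  intro s
  induction s using Finset.induction_on with
  | empty => simp; rfl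
  | insert j s hjs ih =>
    rw [← ih, ← sub_eq_zero, ← coeff_sub]
    set Q : Matrix σ σ (MvPolynomial σ R) := Matrix.of fun j => if j ∈ s then D j else M j with hQ
    have e₁ : (Matrix.of fun k => if k ∈ insert j s then D k else M k) = Q.updateRow j (D j) := by
      ext k l : 2
      by_cases hk : k = j
      · subst hk; simp
      · simp [hQ, hk, Matrix.updateRow_ne]
    have e₂ : Q = Q.updateRow j (M j) := by
      ext k l : 2
      by_cases hk : k = j
      · subst hk; simp [hQ, hjs]
      · simp [hk, Matrix.updateRow_ne]
    have e₃ : (Q.updateRow j (D j)).det - Q.det = (Q.updateRow j (D j - M j)).det := by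
      rw [sub_eq_iff_eq_add]
      conv_rhs => rw [e₂]
      rw [Matrix.updateRow_idem, ← Matrix.det_updateRow_add, sub_add_cancel]
    have hz : (Q.updateRow j (D j - M j)).mulVec X j = 0 := by
      have := congrFun h j
      simp only [Matrix.mulVec] at this ⊢
      rw [Matrix.updateRow_self, sub_dotProduct, this, sub_self]
    rw [e₁, e₃]
    refine coeff_det_eq_zero _ j hz fun k => ?_
    by_cases hk : k = j
    · rw [hk, hz]; exact dvd_zero _
    · have : (Q.updateRow j (D j - M j)).mulVec X k = D.mulVec X k := by
        simp only [Matrix.mulVec]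
        rw [Matrix.updateRow_ne hk]
        by_cases hs : k ∈ s
        · simp [hQ, hs]
        · simp only [hQ, Matrix.of_apply, hs, if_false]
          exact congrFun h k
      rw [this]
      exact hD k

theorem det_notMem_span {σ K : Type*} [Fintype σ] [DecidableEq σ] [CommRing K] [IsDomain K]
    (g : σ → MvPolynomial σ K) (a : Matrix σ σ (MvPolynomial σ K))
    (hg : ∀ j, g j = ∑ i, a i j * X i)
    (hp : ∀ i, ∃ p : Polynomial K, p ≠ 0 ∧ Polynomial.aeval (X i) p ∈ Ideal.span (Set.range g)) :
    a.det ∉ Ideal.span (Set.range g) := by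
  intro hdet
  have hp' : ∀ i, ∃ (N : ℕ) (q : Polynomial K), q.coeff 0 ≠ 0 ∧
      X i ^ (N + 1) * Polynomial.aeval (X i : MvPolynomial σ K) q ∈ Ideal.span (Set.range g) := by
    intro i
    obtain ⟨p, hp0, hp⟩ := hp i
    obtain ⟨q, hq, hq'⟩ := Polynomial.exists_eq_pow_rootMultiplicity_mul_and_not_dvd p hp0 0
    rw [map_zero, sub_zero] at hq hq'
    refine ⟨p.rootMultiplicity 0, q, fun h => hq' (Polynomial.X_dvd_iff.2 h), ?_⟩
    rw [hq, map_mul, map_pow, Polynomial.aeval_X] at hp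
    rw [pow_succ', mul_assoc]
    exact Ideal.mul_mem_left _ _ hp
  choose N q hq hmem using hp'
  choose c hc using fun i => Ideal.mem_span_range_iff_exists_fun.1 (hmem i)
  obtain ⟨d, hd⟩ := Ideal.mem_span_range_iff_exists_fun.1 hdet
  let m : σ →₀ ℕ := Finsupp.equivFunOnFinite.symm N
  have hm : ∀ i, m i = N i := fun i => rfl
  let C : Matrix σ σ (MvPolynomial σ K) := Matrix.of c
  let D : Matrix σ σ (MvPolynomial σ K) :=
    Matrix.diagonal fun i => X i ^ N i * Polynomial.aeval (X i) (q i)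
  have hga : a.transpose.mulVec X = g := by
    ext1 j; rw [hg]; rfl
  have hCg : ∀ j, C.mulVec g j = X j ^ (N j + 1) * Polynomial.aeval (X j) (q j) := hc
  have hDX : ∀ j, D.mulVec X j = X j ^ (N j + 1) * Polynomial.aeval (X j) (q j) := by
    intro j; rw [Matrix.mulVec_diagonal]; ring
  have h₁ : coeff m (C * a.transpose).det = coeff m D.det := by
    refine coeff_det_congr _ _ ?_ fun k => ?_
    · rw [← Matrix.mulVec_mulVec, hga]
      ext1 j; rw [hCg, hDX]
    · rw [hDX]; exact dvd_mul_right _ _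
  have h₂ : coeff m (C * a.transpose).det = 0 := by
    rw [Matrix.det_mul, Matrix.det_transpose, ← hd, Finset.mul_sum, coeff_sum]
    refine Finset.sum_eq_zero fun k _ => ?_
    have h : C.det * g k = ∑ j, C.adjugate k j * C.mulVec g j := by
      have h : (C.adjugate.mulVec (C.mulVec g)) k = (C.det • g) k := by
        rw [Matrix.mulVec_mulVec, Matrix.adjugate_mul, Matrix.smul_mulVec, Matrix.one_mulVec]
      simpa [Matrix.mulVec, dotProduct] using h.symm
    rw [mul_left_comm, h, Finset.mul_sum, coeff_sum]
    refine Finset.sum_eq_zero fun j _ => ?_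
    rw [hCg, mul_comm (X j ^ _), ← mul_assoc, ← mul_assoc]
    exact coeff_mul_X_pow_eq_zero (by rw [hm]; omega) _
  have h₃ : coeff m D.det = ∏ i, (q i).coeff 0 := by
    have : (∏ i, (X i : MvPolynomial σ K) ^ N i) = monomial m 1 := by
      rw [monomial_eq, C_1, one_mul, Finsupp.prod_fintype _ _ (by simp)]
      rfl
    rw [Matrix.det_diagonal, Finset.prod_mul_distrib, this]
    have h := coeff_monomial_mul 0 m (1 : K) (∏ i, Polynomial.aeval (X i) (q i))
    rw [add_zero, one_mul] at h
    rw [h, ← constantCoeff_eq, map_prod]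
    refine Finset.prod_congr rfl fun i _ => ?_
    rw [Polynomial.aeval_def, Polynomial.hom_eval₂, constantCoeff_X, Polynomial.eval₂_at_zero]
    simp [algebraMap_eq]
  exact Finset.prod_ne_zero_iff.2 (fun i _ => hq i) (h₃.symm.trans (h₁.symm.trans h₂))

end MvPolynomial

section Chi

variable {A B : Type*} [CommRing A] [CommRing B] [Algebra A B]

theorem chi_tmul (b c : B) (φ : Module.Dual A B) : chi A B (b ⊗ₜ c) φ = φ b • c := by
  simp [chi]

theorem chi_tmul_one_mul (b : B) (t : B ⊗[A] B) (φ : Module.Dual A B) :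
    chi A B ((b ⊗ₜ 1) * t) φ = chi A B t (φ ∘ₗ LinearMap.mulLeft A b) := by
  induction t with
  | zero => simp
  | add x y hx hy => rw [mul_add, map_add, map_add, LinearMap.add_apply, hx, hy]; rfl
  | tmul x y => simp [chi_tmul]

theorem chi_one_tmul_mul (b : B) (t : B ⊗[A] B) (φ : Module.Dual A B) :
    chi A B ((1 ⊗ₜ b) * t) φ = b * chi A B t φ := by
  induction t with
  | zero => simp
  | add x y hx hy =>
    rw [mul_add, map_add, map_add, LinearMap.add_apply, hx, hy, LinearMap.add_apply, mul_add]
  | tmul x y => simp [chi_tmul]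

/-- The transpose of `chi t` is `chi` of the swapped tensor. -/
theorem dual_chi_apply (t : B ⊗[A] B) (φ ψ : Module.Dual A B) :
    ψ (chi A B t φ) = φ (chi A B (Algebra.TensorProduct.comm A B B t) ψ) := by
  induction t with
  | zero => simp
  | add x y hx hy => simp only [map_add, LinearMap.add_apply, hx, hy]
  | tmul x y => simp [chi_tmul, mul_comm]

variable (A B) in
theorem exists_sum_tmul_chi [Module.Finite A B] [Module.Projective A B] :
    ∃ (k : ℕ) (b : Fin k → B) (φ : Fin k → Module.Dual A B),
      ∀ t : B ⊗[A] B, t = ∑ r, b r ⊗ₜ chi A B t (φ r) := by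
  obtain ⟨k, p, s, -, -, hps⟩ := Module.Finite.exists_comp_eq_id_of_projective A B
  have hsum : ∀ x : B, x = ∑ r, s x r • p (Pi.single r 1) := by
    intro x
    conv_lhs => rw [← LinearMap.id_apply (R := A) x, ← hps, LinearMap.comp_apply,
      pi_eq_sum_univ' (s x), map_sum]
    simp [map_smul]
  refine ⟨k, fun r => p (Pi.single r 1), fun r => LinearMap.proj r ∘ₗ s, fun t => ?_⟩
  induction t with
  | zero => simp
  | add x y hx hy =>
    simp only [map_add, LinearMap.add_apply, TensorProduct.tmul_add, Finset.sum_add_distrib]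
    rw [← hx, ← hy]
  | tmul x y =>
    conv_lhs => rw [hsum x, TensorProduct.sum_tmul]
    simp [chi_tmul, TensorProduct.smul_tmul]

end Chi

section Delta

variable {σ A B : Type*} [Fintype σ] [DecidableEq σ] [CommRing A] [CommRing B] [Algebra A B]

theorem tmul_one_mul_map_det_eq (π : MvPolynomial σ A →ₐ[A] B) (hπ : Function.Surjective π)
    (f : σ → MvPolynomial σ A) (hf : ∀ j, π (f j) = 0)
    (a : Matrix σ σ (MvPolynomial σ A ⊗[A] MvPolynomial σ A))
    (ha : ∀ j, (f j) ⊗ₜ[A] 1 - 1 ⊗ₜ[A] (f j) =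
      ∑ i, a i j * ((MvPolynomial.X i) ⊗ₜ[A] 1 - 1 ⊗ₜ[A] (MvPolynomial.X i))) (b : B) :
    (b ⊗ₜ[A] 1) * Algebra.TensorProduct.map π π a.det =
      (1 ⊗ₜ[A] b) * Algebra.TensorProduct.map π π a.det := by
  let Φ := Algebra.TensorProduct.map π π
  let M : Matrix σ σ (B ⊗[A] B) := (Φ.mapMatrix a).transpose
  let x : σ → B ⊗[A] B := fun i => π (.X i) ⊗ₜ 1 - 1 ⊗ₜ π (.X i)
  have hM : M.mulVec x = 0 := by
    ext1 j
    have h := congrArg Φ (ha j)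
    simp only [map_sub, map_sum, map_mul, Φ, Algebra.TensorProduct.map_tmul, hf, map_one,
      TensorProduct.zero_tmul, TensorProduct.tmul_zero, sub_zero] at h
    exact h.symm
  have hdet : M.det = Φ a.det := by
    rw [Matrix.det_transpose, AlgHom.map_det]
  have hx : ∀ i, x i * Φ a.det = 0 := by
    intro i
    have h : (M.adjugate.mulVec (M.mulVec x)) i = (M.det • x) i := by
      rw [Matrix.mulVec_mulVec, Matrix.adjugate_mul, Matrix.smul_mulVec, Matrix.one_mulVec]
    rw [hM, Matrix.mulVec_zero, hdet] at h
    rw [mul_comm]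
    exact h.symm
  obtain ⟨p, rfl⟩ := hπ b
  change _ * Φ a.det = _ * Φ a.det
  induction p using MvPolynomial.induction_on with
  | C r =>
    rw [← MvPolynomial.algebraMap_eq, AlgHom.commutes, Algebra.algebraMap_eq_smul_one,
      TensorProduct.smul_tmul]
  | add p q hp hq => rw [map_add, TensorProduct.add_tmul, TensorProduct.tmul_add, add_mul, add_mul,
      hp, hq]
  | mul_X p i hp =>
    have h := hx i
    rw [sub_mul, sub_eq_zero] at h
    have e₁ : π (p * .X i) ⊗ₜ[A] (1 : B) = (π p ⊗ₜ 1) * (π (.X i) ⊗ₜ 1) := by simp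
    have e₂ : (1 : B) ⊗ₜ[A] π (p * .X i) = (1 ⊗ₜ π (.X i)) * (1 ⊗ₜ π p) := by simp [mul_comm]
    rw [e₁, e₂, mul_assoc, h, mul_left_comm, hp, mul_assoc]

theorem chi_map_det_surjective (f : σ → MvPolynomial σ A)
    [Module.Finite A (MvPolynomial σ A ⧸ Ideal.span (Set.range f))]
    [Module.Projective A (MvPolynomial σ A ⧸ Ideal.span (Set.range f))]
    (a : Matrix σ σ (MvPolynomial σ A ⊗[A] MvPolynomial σ A))
    (ha : ∀ j, (f j) ⊗ₜ[A] 1 - 1 ⊗ₜ[A] (f j) =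
      ∑ i, a i j * ((MvPolynomial.X i) ⊗ₜ[A] 1 - 1 ⊗ₜ[A] (MvPolynomial.X i))) :
    Function.Surjective (chi A (MvPolynomial σ A ⧸ Ideal.span (Set.range f))
      (Algebra.TensorProduct.map (Ideal.Quotient.mkₐ A (Ideal.span (Set.range f)))
        (Ideal.Quotient.mkₐ A (Ideal.span (Set.range f))) a.det)) := by
  set I := Ideal.span (Set.range f) with hI
  set π := Ideal.Quotient.mkₐ A I
  have hπf : ∀ j, π (f j) = 0 := fun j =>
    Ideal.Quotient.eq_zero_iff_mem.2 (Ideal.subset_span ⟨j, rfl⟩)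
  set Δ := Algebra.TensorProduct.map π π a.det with hΔ
  have hlin : ∀ b, (b ⊗ₜ[A] 1) * Δ = (1 ⊗ₜ[A] b) * Δ :=
    tmul_one_mul_map_det_eq π (Ideal.Quotient.mkₐ_surjective A I) f hπf a ha
  let J : Ideal (MvPolynomial σ A ⧸ I) :=
    { (LinearMap.range (chi A _ Δ)).toAddSubmonoid with
      smul_mem' := by
        rintro b _ ⟨φ, rfl⟩
        exact ⟨φ ∘ₗ LinearMap.mulLeft A b, by
          rw [← chi_tmul_one_mul, hlin, chi_one_tmul_mul, smul_eq_mul]⟩ }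
  suffices hJ : J = ⊤ by
    intro b
    exact (hJ ▸ Submodule.mem_top : b ∈ J)
  by_contra hJ
  obtain ⟨K, _, _, κ, hκ⟩ : ∃ (K : Type _) (_ : Field K) (_ : Algebra A K)
      (κ : (MvPolynomial σ A ⧸ I) →ₐ[A] K), ∀ x ∈ J, κ x = 0 := by
    obtain ⟨𝔫, h𝔫, hJ𝔫⟩ := Ideal.exists_le_maximal J hJ
    exact ⟨_, Ideal.Quotient.field 𝔫, inferInstance, Ideal.Quotient.mkₐ A 𝔫,
      fun x hx => Ideal.Quotient.eq_zero_iff_mem.2 (hJ𝔫 hx)⟩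
  let β : (MvPolynomial σ A ⧸ I) →ₐ[A] MvPolynomial σ K :=
    (IsScalarTower.toAlgHom A K (MvPolynomial σ K)).comp κ
  let α : MvPolynomial σ A →ₐ[A] MvPolynomial σ K :=
    MvPolynomial.aeval fun i => MvPolynomial.X i + β (π (MvPolynomial.X i))
  let ev : MvPolynomial σ A ⊗[A] MvPolynomial σ A →ₐ[A] MvPolynomial σ K :=
    Algebra.TensorProduct.productMap α (β.comp π)
  let g : σ → MvPolynomial σ K := fun j => α (f j)
  let q := Ideal.Quotient.mkₐ A (Ideal.span (Set.range g))
  have hI_le : I ≤ RingHom.ker (q.comp α) := by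
    rw [hI, Ideal.span_le]
    rintro _ ⟨j, rfl⟩
    exact Ideal.Quotient.eq_zero_iff_mem.2 (Ideal.subset_span ⟨j, rfl⟩)
  let γ : (MvPolynomial σ A ⧸ I) →ₐ[A] MvPolynomial σ K ⧸ Ideal.span (Set.range g) :=
    Ideal.Quotient.liftₐ I (q.comp α) fun x hx => hI_le hx
  let Ψ := Algebra.TensorProduct.productMap γ (q.comp β)
  have hΨ : Ψ.comp (Algebra.TensorProduct.map π π) = q.comp ev := by
    apply Algebra.TensorProduct.ext'
    intro x y
    simp only [AlgHom.comp_apply, Algebra.TensorProduct.map_tmul, Ψ, ev,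
      Algebra.TensorProduct.productMap_apply_tmul, map_mul]
    rfl
  have hzero : Ψ Δ = 0 := by
    obtain ⟨k, b, φ, h⟩ := exists_sum_tmul_chi A (MvPolynomial σ A ⧸ I)
    rw [h Δ, map_sum]
    refine Finset.sum_eq_zero fun r _ => ?_
    have h0 : κ (chi A _ Δ (φ r)) = 0 := hκ _ ⟨φ r, rfl⟩
    simp only [Ψ, Algebra.TensorProduct.productMap_apply_tmul, AlgHom.comp_apply, β, h0, map_zero,
      mul_zero]
  refine MvPolynomial.det_notMem_span g (ev.mapMatrix a) (fun j => ?_) (fun i => ?_) ?_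
  · have h := congrArg ev (ha j)
    simpa [ev, α, hπf, g] using h
  · obtain ⟨p, hp, hp0⟩ := Algebra.IsIntegral.isIntegral (R := A) (π (MvPolynomial.X i))
    refine ⟨Polynomial.taylor (κ (π (MvPolynomial.X i)))
      (p.map (algebraMap A K)), ?_, ?_⟩
    · rw [Ne, Polynomial.taylor_eq_zero]
      exact (hp.map _).ne_zero
    · rw [← Polynomial.aeval_def, Polynomial.aeval_algHom_apply] at hp0
      have h1 : Polynomial.aeval (MvPolynomial.X i) p ∈ I := Ideal.Quotient.eq_zero_iff_mem.1 hp0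
      have h2 : α (Polynomial.aeval (MvPolynomial.X i) p) ∈ Ideal.span (Set.range g) :=
        Ideal.Quotient.eq_zero_iff_mem.1 (hI_le h1)
      convert h2 using 1
      rw [← Polynomial.aeval_algHom_apply, Polynomial.taylor_apply, Polynomial.aeval_comp,
        Polynomial.aeval_map_algebraMap]
      simp [α, β, MvPolynomial.algebraMap_eq]
  · rw [← AlgHom.map_det]
    have h := DFunLike.congr_fun hΨ a.det
    rw [AlgHom.comp_apply, ← hΔ, hzero] at h
    exact Ideal.Quotient.eq_zero_iff_mem.1 h.symm

end Delta

/-- **Scheja–Storch, Theorem 3.3**: for a finite flat complete-intersection presentation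
`B = A[x₁,…,xₙ]/(f₁,…,fₙ)` with `Δ = (π⊗π)(det aᵢⱼ)`, where
`fⱼ⊗1 - 1⊗fⱼ = ∑ᵢ aᵢⱼ (xᵢ⊗1 - 1⊗xᵢ)`, the map `χ(Δ) : Hom_A(B, A) → B` is an isomorphism
of `B`-modules (here `B`-linearity for the module structure `(b·φ)(x) = φ(bx)` on
`Hom_A(B, A)` is expressed pointwise, via precomposition with `LinearMap.mulLeft A b`). -/
theorem chi_delta_bijective {A : Type*} [CommRing A] [IsNoetherianRing A] {n : ℕ}
    (f : Fin n → MvPolynomial (Fin n) A)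
    [Module.Finite A (MvPolynomial (Fin n) A ⧸ Ideal.span (Set.range f))]
    [Module.Flat A (MvPolynomial (Fin n) A ⧸ Ideal.span (Set.range f))]
    (a : Matrix (Fin n) (Fin n)
      (TensorProduct A (MvPolynomial (Fin n) A) (MvPolynomial (Fin n) A)))
    (ha : ∀ j, (f j) ⊗ₜ[A] 1 - 1 ⊗ₜ[A] (f j) =
      ∑ i, a i j * ((MvPolynomial.X i) ⊗ₜ[A] 1 - 1 ⊗ₜ[A] (MvPolynomial.X i))) :
    (∀ (b : MvPolynomial (Fin n) A ⧸ Ideal.span (Set.range f))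
        (φ : Module.Dual A (MvPolynomial (Fin n) A ⧸ Ideal.span (Set.range f))),
      chi A (MvPolynomial (Fin n) A ⧸ Ideal.span (Set.range f))
          (Algebra.TensorProduct.map
            (Ideal.Quotient.mkₐ A (Ideal.span (Set.range f)))
            (Ideal.Quotient.mkₐ A (Ideal.span (Set.range f))) a.det)
          (φ ∘ₗ LinearMap.mulLeft A b) =
        b * chi A (MvPolynomial (Fin n) A ⧸ Ideal.span (Set.range f))
          (Algebra.TensorProduct.map
            (Ideal.Quotient.mkₐ A (Ideal.span (Set.range f)))
            (Ideal.Quotient.mkₐ A (Ideal.span (Set.range f))) a.det) φ) ∧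
    Function.Bijective
      (chi A (MvPolynomial (Fin n) A ⧸ Ideal.span (Set.range f))
        (Algebra.TensorProduct.map
          (Ideal.Quotient.mkₐ A (Ideal.span (Set.range f)))
          (Ideal.Quotient.mkₐ A (Ideal.span (Set.range f))) a.det)) := by
  have : Module.Projective A (MvPolynomial (Fin n) A ⧸ Ideal.span (Set.range f)) :=
    have := Module.finitePresentation_of_finite A
      (MvPolynomial (Fin n) A ⧸ Ideal.span (Set.range f))
    Module.Flat.projective_of_finitePresentation
  have hsurj := chi_map_det_surjective f a ha
  let swap := Algebra.TensorProduct.comm A (MvPolynomial (Fin n) A) (MvPolynomial (Fin n) A)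
  have hswap := chi_map_det_surjective f (swap.toAlgHom.mapMatrix a) fun j => by
    have h := congrArg (fun t => -swap t) (ha j)
    simp only [map_sub, map_sum, map_mul, swap, Algebra.TensorProduct.comm_tmul, neg_sub,
      ← Finset.sum_neg_distrib] at h
    refine h.trans (Finset.sum_congr rfl fun i _ => ?_)
    change _ = swap (a i j) * _
    ring
  set π := Ideal.Quotient.mkₐ A (Ideal.span (Set.range f))
  have hcomm : Algebra.TensorProduct.map π π (swap.toAlgHom.mapMatrix a).det =
      Algebra.TensorProduct.comm A _ _ (Algebra.TensorProduct.map π π a.det) := by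
    rw [← AlgHom.map_det]
    generalize a.det = t
    induction t with
    | zero => simp
    | add x y hx hy => simp only [map_add, hx, hy]
    | tmul x y => simp [swap]
  refine ⟨fun b φ => ?_, ?_, hsurj⟩
  · rw [← chi_tmul_one_mul, ← chi_one_tmul_mul,
      tmul_one_mul_map_det_eq π (Ideal.Quotient.mkₐ_surjective A _) f
        (fun j => Ideal.Quotient.eq_zero_iff_mem.2 (Ideal.subset_span ⟨j, rfl⟩)) a ha]
  · rw [injective_iff_map_eq_zero]
    intro φ hφ
    ext1 b
    obtain ⟨ψ, rfl⟩ := hswap b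
    rw [hcomm, ← dual_chi_apply, hφ, map_zero, LinearMap.zero_apply]
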